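/- (Stochastic approximation lemma) Let (Ω, F, P) be a probability space with a filtration (P_t)_{t≥0}, X a finite set, and (ζ_t), (Δ_t), (F_t) stochastic processes with values in the functions X → ℝ satisfying Δ_{t+1}(x) = (1 − ζ_t(x)) Δ_t(x) + ζ_t(x) F_t(x) for all x ∈ X and t ≥ 0, where ζ_0 and Δ_0 are P_0-measurable and ζ_t, Δ_t, F_{t−1} are P_t-measurable for all t. Assume: (i) ζ_t(x) ∈ [0,1] for all t, x; (ii) ∑_t ζ_t(x) = ∞ and ∑_t ζ_t(x)² < ∞ almost surely, for every x ∈ X; (iii) there exist κ ∈ [0,1) and nonnegative random variables c_t with c_t → 0 almost surely such that ‖E[F_t | P_t]‖ ≤ κ‖Δ_t‖ + c_t almost surely, where ‖·‖ denotes the maximum norm over x ∈ X; (iv) there is a constant K with Var[F_t(x) | P_t] ≤ K(1 + κ‖Δ_t‖)² almost surely for all t, x. Then Δ_t converges to 0 (in maximum norm) almost surely. -/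

import Mathlib

open MeasureTheory Filter
open scoped BigOperators

lemma sal_noise (z w B : ℕ → ℝ) (hz : ∀ t, z t ∈ Set.Icc (0:ℝ) 1) (hB : Monotone B)
    (hB0 : ∀ t, 0 ≤ B t) (hconv : CauchySeq (fun t => ∑ s ∈ Finset.range t, z s * w s))
    (η : ℝ) (hη : 0 < η) :
    ∀ᶠ t0 in atTop, ∀ N : ℕ → ℝ, N 0 = 0 →
      (∀ k, N (k+1) = (1 - z (t0+k)) * N k + z (t0+k) * (B (t0+k) * w (t0+k))) →
      ∀ k, |N k| ≤ 2 * η * B (t0+k) ∧ |N (k+1)| ≤ 2 * η * B (t0+k) := by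
  obtain ⟨T, hT⟩ := Metric.cauchySeq_iff'.1 hconv (η/2) (by positivity)
  filter_upwards [eventually_ge_atTop T] with t0 ht0 N hN0 hN
  set S : ℕ → ℝ := fun t => ∑ s ∈ Finset.range t, z s * w s with hS
  set R : ℕ → ℝ := fun k => S (t0+k) - S t0 with hR
  have hRb : ∀ k, |R k| ≤ η := by
    intro k
    have h1 := hT (t0+k) (by omega)
    have h2 := hT t0 ht0
    rw [Real.dist_eq] at h1 h2
    rw [abs_lt] at h1 h2
    rw [abs_le]
    constructor <;> simp only [hR] <;> linarith [h1.1, h1.2, h2.1, h2.2]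
  have hRs : ∀ k, R (k+1) = R k + z (t0+k) * w (t0+k) := by
    intro k
    simp only [hR, hS, ← add_assoc, Finset.sum_range_succ]; ring
  have step : ∀ k, |N k - B (t0+k) * R k| ≤ B (t0+k) * η →
      |N (k+1) - B (t0+k) * R (k+1)| ≤ B (t0+k) * η := by
    intro k hk
    have e : N (k+1) - B (t0+k) * R (k+1) =
        (1 - z (t0+k)) * (N k - B (t0+k) * R k) + z (t0+k) * (-(B (t0+k) * R k)) := by
      rw [hN, hRs]; ring
    have hz1 := hz (t0+k)
    have hb : |B (t0+k) * R k| ≤ B (t0+k) * η := by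
      rw [abs_mul, abs_of_nonneg (hB0 _)]
      exact mul_le_mul_of_nonneg_left (hRb k) (hB0 _)
    rw [e]
    calc _ ≤ |(1 - z (t0+k)) * (N k - B (t0+k) * R k)| + |z (t0+k) * (-(B (t0+k) * R k))| :=
          abs_add_le _ _
      _ = (1 - z (t0+k)) * |N k - B (t0+k) * R k| + z (t0+k) * |B (t0+k) * R k| := by
          rw [abs_mul, abs_mul, abs_neg, abs_of_nonneg hz1.1, abs_of_nonneg (by linarith [hz1.2] : 0 ≤ 1 - z (t0+k))]
      _ ≤ (1 - z (t0+k)) * (B (t0+k) * η) + z (t0+k) * (B (t0+k) * η) :=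
          add_le_add (mul_le_mul_of_nonneg_left hk (by linarith [hz1.2]))
            (mul_le_mul_of_nonneg_left hb hz1.1)
      _ = _ := by ring
  have main : ∀ k, |N k - B (t0+k) * R k| ≤ B (t0+k) * η := by
    intro k
    induction k with
    | zero => simp [hN0, hR]; exact mul_nonneg (hB0 _) hη.le
    | succ k ih =>
      have h1 := step k ih
      have hm : B (t0+k) ≤ B (t0+(k+1)) := hB (by omega)
      have h2 : |(B (t0+(k+1)) - B (t0+k)) * R (k+1)| ≤ (B (t0+(k+1)) - B (t0+k)) * η := by
        rw [abs_mul, abs_of_nonneg (by linarith)]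
        exact mul_le_mul_of_nonneg_left (hRb _) (by linarith)
      rw [abs_le] at *
      constructor <;> nlinarith [h1.1, h1.2, h2.1, h2.2]
  intro k
  have h0 := main k
  have h1 := step k h0
  have hb : ∀ j, |B (t0+k) * R j| ≤ B (t0+k) * η := by
    intro j
    rw [abs_mul, abs_of_nonneg (hB0 _)]
    exact mul_le_mul_of_nonneg_left (hRb j) (hB0 _)
  have hb0 := hb k
  have hb1 := hb (k+1)
  rw [abs_le] at h0 h1 hb0 hb1
  constructor <;> rw [abs_le] <;> constructor <;> linarith [h0.1, h0.2, h1.1, h1.2, hb0.1, hb0.2, hb1.1, hb1.2]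

lemma sal_convex {a z D G A : ℝ} (hz : z ∈ Set.Icc (0:ℝ) 1) (hD : |D| ≤ a) (hG : |G| ≤ A) :
    |(1 - z) * D + z * G| ≤ (1 - z) * a + z * A := by
  calc _ ≤ |(1-z) * D| + |z * G| := abs_add_le _ _
    _ = (1 - z) * |D| + z * |G| := by
      rw [abs_mul, abs_mul, abs_of_nonneg hz.1, abs_of_nonneg (by linarith [hz.2] : 0 ≤ 1 - z)]
    _ ≤ _ := add_le_add (mul_le_mul_of_nonneg_left hD (by linarith [hz.2]))
            (mul_le_mul_of_nonneg_left hG hz.1)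

lemma sal_decay (z D G : ℕ → ℝ) (A : ℝ) (hz : ∀ t, z t ∈ Set.Icc (0:ℝ) 1)
    (hdiv : Tendsto (fun T => ∑ t ∈ Finset.range T, z t) atTop atTop)
    (hD : ∀ k, D (k+1) = (1 - z k) * D k + z k * G k) (hG : ∀ k, |G k| ≤ A)
    (ε : ℝ) (hε : 0 < ε) : ∀ᶠ k in atTop, |D k| ≤ A + ε := by
  have hA : 0 ≤ A := (abs_nonneg _).trans (hG 0)
  have key : ∀ k, |D k| ≤ A + |D 0| * Real.exp (-∑ t ∈ Finset.range k, z t) := by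
    intro k
    induction k with
    | zero => simp [hA]
    | succ k ih =>
      rw [hD]
      refine (sal_convex (hz k) ih (hG k)).trans ?_
      rw [Finset.sum_range_succ, neg_add, Real.exp_add]
      have h1 : 1 - z k ≤ Real.exp (-z k) := Real.one_sub_le_exp_neg _
      have h2 : 0 ≤ |D 0| * Real.exp (-∑ t ∈ Finset.range k, z t) := by positivity
      nlinarith [mul_le_mul_of_nonneg_left h1 h2]
  have ht : Tendsto (fun k => |D 0| * Real.exp (-∑ t ∈ Finset.range k, z t)) atTop (nhds 0) := by
    have := (Real.tendsto_exp_neg_atTop_nhds_zero.comp hdiv).const_mul |D 0|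
    simpa using this
  filter_upwards [ht.eventually (eventually_le_nhds hε)] with k hk
  linarith [key k]

lemma sal_det {X : Type*} [Fintype X] (z d w G : ℕ → X → ℝ) (c B : ℕ → ℝ) (κ : ℝ)
    (hκ : κ ∈ Set.Ico (0:ℝ) 1)
    (hz : ∀ t x, z t x ∈ Set.Icc (0:ℝ) 1)
    (hrec : ∀ t x, d (t+1) x = (1 - z t x) * d t x + z t x * (G t x + B t * w t x))
    (hB : Monotone B) (hB1 : ∀ t, 1 ≤ B t) (hdB : ∀ t x, |d t x| ≤ B t)
    (hBs : ∀ t M, B t ≤ M → (∀ x, |d (t+1) x| ≤ M) → B (t+1) ≤ M)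
    (hdiv : ∀ x, Tendsto (fun T => ∑ t ∈ Finset.range T, z t x) atTop atTop)
    (hconv : ∀ x, CauchySeq (fun t => ∑ s ∈ Finset.range t, z s x * w s x))
    (hc : Tendsto c atTop (nhds 0))
    (hG : ∀ t L, (∀ x, |d t x| ≤ L) → ∀ x, |G t x| ≤ κ * L + c t)
    (ε : ℝ) (hε : 0 < ε) : ∀ᶠ t in atTop, ∀ x, |d t x| ≤ ε := by
  obtain ⟨hκ0, hκ1⟩ := hκ
  have hB0 : ∀ t, 0 ≤ B t := fun t => zero_le_one.trans (hB1 t)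
  have noise : ∀ η : ℝ, 0 < η → ∀ᶠ t0 in atTop, ∃ N : X → ℕ → ℝ, 
      (∀ x, N x 0 = 0) ∧
      (∀ x k, |N x k| ≤ 2 * η * B (t0+k) ∧ |N x (k+1)| ≤ 2 * η * B (t0+k)) ∧
      (∀ x k, d (t0+(k+1)) x - N x (k+1) =
        (1 - z (t0+k) x) * (d (t0+k) x - N x k) + z (t0+k) x * G (t0+k) x) := by
    intro η hη
    have h := fun x => sal_noise (fun t => z t x) (fun t => w t x) B (fun t => hz t x) hB hB0
      (hconv x) η hη
    filter_upwards [eventually_all.2 h] with t0 ht0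
    let N : X → ℕ → ℝ := fun x k => Nat.rec (motive := fun _ => ℝ) 0
      (fun k n => (1 - z (t0+k) x) * n + z (t0+k) x * (B (t0+k) * w (t0+k) x)) k
    refine ⟨N, fun x => rfl, fun x k => ht0 x (N x) rfl (fun k => rfl) k, fun x k => ?_⟩
    have e : N x (k+1) = (1 - z (t0+k) x) * N x k + z (t0+k) x * (B (t0+k) * w (t0+k) x) := rfl
    rw [e, ← add_assoc, hrec]; ring
  -- boundedness
  have bdd : ∃ M, 0 < M ∧ ∀ t, B t ≤ M := by
    set η : ℝ := (1 - κ) / 8 with hη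
    have hη0 : 0 < η := by rw [hη]; linarith
    have hη1 : η ≤ 1/8 := by rw [hη]; linarith
    have hcη : ∀ᶠ t in atTop, ∀ s ≥ t, c s ≤ η :=
      (eventually_forall_ge_atTop.2 (hc.eventually (eventually_le_nhds hη0)))
    obtain ⟨t0, ⟨N, hN0, hNb, hNr⟩, hct⟩ := ((noise η hη0).and hcη).exists
    set M := B t0 / (1 - 2 * η) with hM
    have h12 : 0 < 1 - 2 * η := by linarith
    have hMe : B t0 = (1 - 2*η) * M := by rw [hM]; field_simp
    have hM0 : 0 < M := div_pos (by linarith [hB1 t0]) h12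
    have ind : ∀ k, B (t0+k) ≤ M ∧ ∀ x, |d (t0+k) x - N x k| ≤ B t0 := by
      intro k
      induction k with
      | zero =>
        refine ⟨?_, fun x => ?_⟩
        · simp only [add_zero]; nlinarith
        · simpa [hN0] using hdB t0 x
      | succ k ih =>
        obtain ⟨ih1, ih2⟩ := ih
        have hD : ∀ x, |d (t0+(k+1)) x - N x (k+1)| ≤ B t0 := by
          intro x
          have hGx : |G (t0+k) x| ≤ B t0 := by
            refine (hG (t0+k) (B (t0+k)) (hdB _) x).trans ?_
            have := hct (t0+k) (by omega)
            have h1 := hB1 (t0+k)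
            have : κ * B (t0+k) + c (t0+k) ≤ (κ + η) * B (t0+k) := by nlinarith
            have h3 : (κ + η) * B (t0+k) ≤ (κ+η) * M :=
              mul_le_mul_of_nonneg_left ih1 (by linarith)
            have h4 : (κ+η) * M ≤ (1 - 2*η) * M :=
              mul_le_mul_of_nonneg_right (by rw [hη]; linarith) hM0.le
            linarith
          rw [hNr]
          exact (sal_convex (hz _ x) (ih2 x) hGx).trans (by linarith)
        refine ⟨hBs _ _ ih1 fun x => ?_, hD⟩
        have h1 := (hNb x k).2
        have h2 := hD x
        have h3 : 2 * η * B (t0+k) ≤ 2 * η * M := mul_le_mul_of_nonneg_left ih1 (by linarith)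
        have h4 : |d (t0+(k+1)) x| ≤ |d (t0+(k+1)) x - N x (k+1)| + |N x (k+1)| := by
          simpa using abs_add_le (d (t0+(k+1)) x - N x (k+1)) (N x (k+1))
        change |d (t0+(k+1)) x| ≤ M
        linarith
    exact ⟨M, hM0, fun t => (hB (by omega : t ≤ t0 + t)).trans (ind t).1⟩
  obtain ⟨M, hM0, hM⟩ := bdd
  have contr : ∀ L, 0 < L → (∀ᶠ t in atTop, ∀ x, |d t x| ≤ L) →
      ∀ᶠ t in atTop, ∀ x, |d t x| ≤ (1+κ)/2 * L := by
    intro L hL hdL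
    set e := (1 - κ) / 8 * L with he
    have he0 : 0 < e := mul_pos (by linarith) hL
    have h1 : ∀ᶠ t in atTop, ∀ s ≥ t, c s ≤ e :=
      (eventually_forall_ge_atTop.2 (hc.eventually (eventually_le_nhds he0)))
    have h2 := eventually_forall_ge_atTop.2 hdL
    obtain ⟨t0, ⟨N, hN0, hNb, hNr⟩, hct, hdt⟩ :=
      ((noise (e / (2*M)) (by positivity)).and (h1.and h2)).exists
    have hdec : ∀ x, ∀ᶠ k in atTop, |d (t0+k) x - N x k| ≤ (κ * L + e) + e := by
      intro x
      refine sal_decay (fun k => z (t0+k) x) (fun k => d (t0+k) x - N x k)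
        (fun k => G (t0+k) x) (κ * L + e) (fun k => hz _ x) ?_ (fun k => hNr x k) ?_ e he0
      · have h3 : Tendsto (fun k => ∑ t ∈ Finset.range (t0 + k), z t x) atTop atTop :=
          (hdiv x).comp (tendsto_atTop_mono (fun k => Nat.le_add_left k t0) tendsto_id)
        have h4 := tendsto_atTop_add_const_right atTop (-∑ t ∈ Finset.range t0, z t x) h3
        refine h4.congr fun k => ?_
        rw [Finset.sum_range_add]; ring
      · intro k
        have := hG (t0+k) L (hdt _ (by omega)) x
        have := hct (t0+k) (by omega)
        linarith
    obtain ⟨k0, hk0⟩ := eventually_atTop.1 (eventually_all.2 hdec)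
    filter_upwards [eventually_ge_atTop (t0 + k0)] with t ht x
    obtain ⟨k, rfl⟩ : ∃ k, t = t0 + k := ⟨t - t0, by omega⟩
    have h3 := hk0 k (by omega) x
    have h4 := (hNb x k).1
    have h5 : 2 * (e / (2*M)) * B (t0+k) ≤ e := by
      calc 2 * (e / (2*M)) * B (t0+k) ≤ 2 * (e / (2*M)) * M :=
            mul_le_mul_of_nonneg_left (hM _) (by positivity)
        _ = e := by field_simp
    have h6 : |d (t0+k) x| ≤ |d (t0+k) x - N x k| + |N x k| := by
      simpa using abs_add_le (d (t0+k) x - N x k) (N x k)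
    have h7 : (1+κ)/2 * L = κ * L + 4 * e := by rw [he]; ring
    linarith
  have iter : ∀ n : ℕ, ∀ᶠ t in atTop, ∀ x, |d t x| ≤ ((1+κ)/2)^n * M := by
    intro n
    induction n with
    | zero => exact Eventually.of_forall fun t x => by simpa using (hdB t x).trans (hM t)
    | succ n ih =>
      have := contr _ (by positivity) ih
      filter_upwards [this] with t ht x
      refine (ht x).trans (le_of_eq ?_)
      ring
  have hlim : Tendsto (fun n : ℕ => ((1+κ)/2)^n * M) atTop (nhds 0) := by
    simpa using (tendsto_pow_atTop_nhds_zero_of_lt_one (by linarith : 0 ≤ (1+κ)/2)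
      (by linarith)).mul_const M
  obtain ⟨n, hn⟩ := (hlim.eventually (eventually_le_nhds hε)).exists
  filter_upwards [iter n] with t ht x
  exact (ht x).trans hn

lemma sal_mart {Ω : Type*} {m : MeasurableSpace Ω} (μ : Measure Ω) [IsProbabilityMeasure μ]
    (ℱ : Filtration ℕ m) (Y V : ℕ → Ω → ℝ) (R : ℝ)
    (hY : ∀ t, Measurable[ℱ (t+1)] (Y t)) (hY2 : ∀ t, MemLp (Y t) 2 μ)
    (hY0 : ∀ t, μ[Y t | ℱ t] =ᵐ[μ] 0)
    (hV : ∀ t, Integrable (V t) μ)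
    (hYV : ∀ t, μ[fun ω => Y t ω ^ 2 | ℱ t] ≤ᵐ[μ] V t)
    (hR : ∀ t ω, ∑ s ∈ Finset.range t, V s ω ≤ R) :
    ∀ᵐ ω ∂μ, CauchySeq (fun t => ∑ s ∈ Finset.range t, Y s ω) := by
  set S : ℕ → Ω → ℝ := fun t ω => ∑ s ∈ Finset.range t, Y s ω with hS
  have hS2 : ∀ t, MemLp (S t) 2 μ := fun t => memLp_finsetSum _ fun s _ => hY2 s
  have hSm : ∀ t, Measurable[ℱ t] (S t) := by
    intro t
    refine Finset.measurable_fun_sum _ fun s hs => ?_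
    exact (hY s).mono (ℱ.mono (by have := Finset.mem_range.1 hs; omega)) le_rfl
  have hSs : ∀ t, S (t+1) = S t + Y t := by
    intro t; ext ω; simp [hS, Finset.sum_range_succ]
  have hYi : ∀ t, Integrable (Y t) μ := fun t => (hY2 t).integrable one_le_two
  have hSi : ∀ t, Integrable (S t) μ := fun t => (hS2 t).integrable one_le_two
  have hmart : Martingale S ℱ μ := by
    refine martingale_nat (fun t => (hSm t).stronglyMeasurable) hSi fun t => ?_
    rw [hSs]
    have h1 := condExp_add (hSi t) (hYi t) (ℱ t)
    have h2 : μ[S t | ℱ t] = S t :=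
      condExp_of_stronglyMeasurable (ℱ.le t) (hSm t).stronglyMeasurable (hSi t)
    filter_upwards [h1, hY0 t] with ω h1 h3
    rw [h1, Pi.add_apply, h2, h3]; simp
  have hcross : ∀ t, ∫ ω, S t ω * Y t ω ∂μ = 0 := by
    intro t
    have hi : Integrable (S t * Y t) μ := (hS2 t).integrable_mul (hY2 t)
    have h := condExp_mul_of_stronglyMeasurable_left (hSm t).stronglyMeasurable hi (hYi t)
    have h2 : ∫ ω, (μ[S t * Y t | ℱ t]) ω ∂μ = ∫ ω, (S t * Y t) ω ∂μ := integral_condExp (ℱ.le t)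
    have h3 : ∫ ω, (μ[S t * Y t | ℱ t]) ω ∂μ = 0 := by
      rw [integral_congr_ae (g := fun _ => (0:ℝ))]
      · simp
      · filter_upwards [h, hY0 t] with ω h h0
        rw [h, Pi.mul_apply, h0]; simp
    rw [h3] at h2
    exact h2.symm
  have hYsq : ∀ t, ∫ ω, Y t ω ^ 2 ∂μ ≤ ∫ ω, V t ω ∂μ := by
    intro t
    rw [← integral_condExp (ℱ.le t)]
    exact integral_mono_ae integrable_condExp (hV t) (hYV t)
  have hSsq : ∀ t, ∫ ω, S t ω ^ 2 ∂μ ≤ ∑ s ∈ Finset.range t, ∫ ω, V s ω ∂μ := by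
    intro t
    induction t with
    | zero => simp [hS]
    | succ t ih =>
      rw [Finset.sum_range_succ]
      have e : ∫ ω, S (t+1) ω ^ 2 ∂μ
          = ∫ ω, S t ω ^ 2 ∂μ + 2 * ∫ ω, S t ω * Y t ω ∂μ + ∫ ω, Y t ω ^ 2 ∂μ := by
        have i1 := (hS2 t).integrable_sq
        have i2 : Integrable (fun ω => 2 * (S t ω * Y t ω)) μ :=
          ((hS2 t).integrable_mul (hY2 t)).const_mul 2
        have i3 := (hY2 t).integrable_sq
        have i12 : Integrable (fun ω => S t ω ^ 2 + 2 * (S t ω * Y t ω)) μ := i1.add i2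
        rw [← integral_const_mul, ← integral_add i1 i2, ← integral_add i12 i3]
        congr 1; ext ω; rw [hSs]; simp; ring
      rw [e, hcross]
      linarith [hYsq t]
  have hSR : ∀ t, ∫ ω, S t ω ^ 2 ∂μ ≤ R := by
    intro t
    refine (hSsq t).trans ?_
    rw [← integral_finsetSum _ fun s _ => hV s]
    calc _ ≤ ∫ ω, R ∂μ := integral_mono (integrable_finsetSum _ fun s _ => hV s)
            (integrable_const _) (fun ω => hR t ω)
      _ = R := by simp
  have hb : ∀ t, eLpNorm (S t) 1 μ ≤ (Real.toNNReal (1 + R) : ENNReal) := by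
    intro t
    rw [eLpNorm_one_eq_lintegral_enorm, ← ofReal_integral_norm_eq_lintegral_enorm (hSi t)]
    refine ENNReal.ofReal_le_ofReal ?_
    calc ∫ ω, ‖S t ω‖ ∂μ ≤ ∫ ω, (1 + S t ω ^ 2) ∂μ := by
          refine integral_mono (hSi t).norm ((integrable_const _).add (hS2 t).integrable_sq) ?_
          intro ω
          simp only [Real.norm_eq_abs]
          nlinarith [sq_abs (S t ω), sq_nonneg (|S t ω| - 1), abs_nonneg (S t ω)]
      _ = 1 + ∫ ω, S t ω ^ 2 ∂μ := by
          rw [integral_add (integrable_const _) (hS2 t).integrable_sq]; simp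
      _ ≤ 1 + R := by linarith [hSR t]
  filter_upwards [hmart.submartingale.ae_tendsto_limitProcess hb] with ω hω
  exact hω.cauchySeq

lemma sal_noise_conv {Ω : Type*} {m : MeasurableSpace Ω} (μ : Measure Ω) [IsProbabilityMeasure μ]
    (ℱ : Filtration ℕ m) (z f b : ℕ → Ω → ℝ) (C : ℝ) (hC : 0 ≤ C)
    (hz : ∀ t, Measurable[ℱ t] (z t)) (hb : ∀ t, Measurable[ℱ t] (b t))
    (hf : ∀ t, Measurable[ℱ (t+1)] (f t)) (hf2 : ∀ t, MemLp (f t) 2 μ)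
    (hz01 : ∀ t ω, z t ω ∈ Set.Icc (0:ℝ) 1) (hb1 : ∀ t ω, 1 ≤ b t ω)
    (hsq : ∀ᵐ ω ∂μ, Summable fun t => z t ω ^ 2)
    (hvar : ∀ t, ∀ᵐ ω ∂μ, (μ[fun ω' => (f t ω' - (μ[f t | ℱ t]) ω') ^ 2 | ℱ t]) ω
      ≤ C * b t ω ^ 2) :
    ∀ᵐ ω ∂μ, CauchySeq (fun t => ∑ s ∈ Finset.range t,
      z s ω * ((f s ω - (μ[f s | ℱ s]) ω) / b s ω)) := by
  classical
  set W : ℕ → Ω → ℝ := fun t ω => f t ω - (μ[f t | ℱ t]) ω with hW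
  have hW2 : ∀ t, MemLp (W t) 2 μ := fun t => (hf2 t).sub ((hf2 t).condExp one_le_two)
  have hWm : ∀ t, Measurable[ℱ (t+1)] (W t) := fun t =>
    (hf t).sub (stronglyMeasurable_condExp.measurable.mono (ℱ.mono (Nat.le_succ t)) le_rfl)
  have hfi : ∀ t, Integrable (f t) μ := fun t => (hf2 t).integrable one_le_two
  have hWi : ∀ t, Integrable (W t) μ := fun t => (hW2 t).integrable one_le_two
  have hW0 : ∀ t, μ[W t | ℱ t] =ᵐ[μ] 0 := by
    intro t
    have h1 : μ[W t | ℱ t] =ᵐ[μ] μ[f t | ℱ t] - μ[μ[f t | ℱ t] | ℱ t] :=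
      condExp_sub (hfi t) integrable_condExp (ℱ t)
    have h2 : μ[μ[f t | ℱ t] | ℱ t] = μ[f t | ℱ t] :=
      condExp_of_stronglyMeasurable (ℱ.le t) stronglyMeasurable_condExp integrable_condExp
    rw [h2, sub_self] at h1
    exact h1
  -- truncation
  let χ : ℕ → ℕ → Ω → ℝ := fun n t ω =>
    if ∑ r ∈ Finset.range (t+1), z r ω ^ 2 ≤ (n:ℝ) then 1 else 0
  have hχm : ∀ n t, Measurable[ℱ t] (χ n t) := by
    intro n t
    refine Measurable.ite ?_ measurable_const measurable_const
    refine measurableSet_le ?_ measurable_const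
    refine Finset.measurable_fun_sum _ fun s hs => ?_
    exact ((hz s).mono (ℱ.mono (by have := Finset.mem_range.1 hs; omega)) le_rfl).pow_const 2
  have hχ01 : ∀ n t ω, χ n t ω = 0 ∨ χ n t ω = 1 := by
    intro n t ω; simp only [χ]; split_ifs <;> simp
  have key : ∀ n : ℕ, ∀ᵐ ω ∂μ, CauchySeq (fun t => ∑ s ∈ Finset.range t,
      χ n s ω * z s ω / b s ω * W s ω) := by
    intro n
    set a : ℕ → Ω → ℝ := fun t ω => χ n t ω * z t ω / b t ω with ha
    have ham : ∀ t, Measurable[ℱ t] (a t) := fun t => ((hχm n t).mul (hz t)).div (hb t)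
    have hab : ∀ t ω, |a t ω| ≤ 1 := by
      intro t ω
      have h1 := hz01 t ω
      have h2 := hb1 t ω
      simp only [ha]
      rw [abs_le]
      rcases hχ01 n t ω with h | h <;> rw [h]
      · simp
      · rw [one_mul]
        constructor
        · have : 0 ≤ z t ω / b t ω := div_nonneg h1.1 (by linarith)
          linarith
        · rw [div_le_one (by linarith)]; linarith [h1.2]
    have hY2 : ∀ t, MemLp (fun ω => a t ω * W t ω) 2 μ := by
      intro t
      refine (hW2 t).mono (((ham t).mono (ℱ.le t) le_rfl).aestronglyMeasurable.mul
        (hW2 t).aestronglyMeasurable) (Eventually.of_forall fun ω => ?_)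
      rw [norm_mul]
      exact mul_le_of_le_one_left (norm_nonneg _) (hab t ω)
    refine sal_mart μ ℱ (fun t ω => a t ω * W t ω) (fun t ω => C * (χ n t ω * z t ω ^ 2)) (C * n)
      (fun t => ((ham t).mono (ℱ.mono (Nat.le_succ t)) le_rfl).mul (hWm t)) hY2 ?_ ?_ ?_ ?_
    · intro t
      have h := condExp_mul_of_stronglyMeasurable_left (μ := μ) (f := a t) (g := W t)
        (ham t).stronglyMeasurable ((hY2 t).integrable one_le_two) (hWi t)
      filter_upwards [h, hW0 t] with ω h1 h2
      change (μ[a t * W t | ℱ t]) ω = 0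
      rw [h1, Pi.mul_apply, h2]; simp
    · intro t
      refine Integrable.of_bound (C := C) (Measurable.aestronglyMeasurable ?_)
        (Eventually.of_forall fun ω => ?_)
      · exact (((hχm n t).mul ((hz t).pow_const 2)).const_mul C).mono (ℱ.le t) le_rfl
      · have h1 := hz01 t ω
        rw [Real.norm_eq_abs, abs_mul, abs_of_nonneg hC]
        refine mul_le_of_le_one_right hC ?_
        rcases hχ01 n t ω with h | h <;> rw [h]
        · simp
        · rw [one_mul, abs_of_nonneg (sq_nonneg _)]
          exact pow_le_one₀ h1.1 h1.2
    · intro t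
      have e : (fun ω => (a t ω * W t ω) ^ 2) = (fun ω => a t ω ^ 2) * (fun ω => W t ω ^ 2) := by
        ext ω; simp [mul_pow]
      have hi : Integrable ((fun ω => a t ω ^ 2) * (fun ω => W t ω ^ 2)) μ := by
        rw [← e]; exact (hY2 t).integrable_sq
      have h := condExp_mul_of_stronglyMeasurable_left (μ := μ)
        ((ham t).pow_const 2).stronglyMeasurable hi (hW2 t).integrable_sq
      simp only [e]
      filter_upwards [h, hvar t] with ω h1 h2
      rw [h1, Pi.mul_apply]
      refine (mul_le_mul_of_nonneg_left h2 (sq_nonneg _)).trans (le_of_eq ?_)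
      have hb0 : b t ω ≠ 0 := by have := hb1 t ω; positivity
      simp only [ha]
      rcases hχ01 n t ω with h | h <;> rw [h]
      · simp
      · field_simp
    · intro t ω
      rw [← Finset.mul_sum]
      refine mul_le_mul_of_nonneg_left ?_ hC
      induction t with
      | zero => simp
      | succ t ih =>
        by_cases hc : ∑ r ∈ Finset.range (t+1), z r ω ^ 2 ≤ (n:ℝ)
        · refine le_trans (Finset.sum_le_sum fun s _ => ?_) hc
          rcases hχ01 n s ω with h | h <;> rw [h]
          · rw [zero_mul]; positivity
          · rw [one_mul]
        · rw [Finset.sum_range_succ]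
          have : χ n t ω = 0 := if_neg hc
          rw [this]; simpa using ih
  filter_upwards [ae_all_iff.2 key, hsq] with ω h1 h2
  obtain ⟨n, hn⟩ := exists_nat_ge (∑' t, z t ω ^ 2)
  convert h1 n using 1
  ext t
  refine Finset.sum_congr rfl fun s _ => ?_
  have : χ n s ω = 1 := if_pos ((h2.sum_le_tsum _ fun _ _ => sq_nonneg _).trans hn)
  rw [this]
  simp only [W]; ring

/-- running maximum, bounded below by one -/
noncomputable def salRunMax (d : ℕ → ℝ) : ℕ → ℝ
  | 0 => max 1 (d 0)
  | t + 1 => max (salRunMax d t) (d (t + 1))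


/-- Stochastic approximation lemma: consider stochastic processes
`ζ_t, Δ_t, F_t : Ω → X → ℝ` on a finite set `X`, adapted to a filtration `ℱ`, satisfying
`Δ_{t+1}(x) = (1 − ζ_t(x)) Δ_t(x) + ζ_t(x) F_t(x)`.  If the step sizes `ζ_t(x) ∈ [0,1]`
satisfy the Robbins–Monro conditions `∑_t ζ_t(x) = ∞` and `∑_t ζ_t(x)² < ∞` a.s., the
conditional means satisfy `‖E[F_t | ℱ_t]‖ ≤ κ‖Δ_t‖ + c_t` a.s. with `κ ∈ [0,1)` and
`c_t → 0` a.s., and the conditional variances satisfy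
`Var[F_t(x) | ℱ_t] ≤ K (1 + κ‖Δ_t‖)²` a.s., then `Δ_t → 0` in the maximum norm a.s. -/
theorem stochastic_approximation_lemma
    {Ω : Type*} {m : MeasurableSpace Ω} (μ : Measure Ω) [IsProbabilityMeasure μ]
    (ℱ : Filtration ℕ m)
    {X : Type*} [Fintype X] [Nonempty X]
    (ζ Δ F : ℕ → Ω → X → ℝ) (c : ℕ → Ω → ℝ) (κ K : ℝ)
    -- the recursion
    (hrec : ∀ t x ω, Δ (t + 1) ω x = (1 - ζ t ω x) * Δ t ω x + ζ t ω x * F t ω x)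
    -- measurability with respect to the filtration
    (hζ0 : ∀ x, Measurable[ℱ 0] fun ω => ζ 0 ω x)
    (hΔ0 : ∀ x, Measurable[ℱ 0] fun ω => Δ 0 ω x)
    (hζ : ∀ t x, Measurable[ℱ t] fun ω => ζ t ω x)
    (hΔ : ∀ t x, Measurable[ℱ t] fun ω => Δ t ω x)
    (hF : ∀ t x, Measurable[ℱ (t + 1)] fun ω => F t ω x)
    -- integrability (so that the conditional expectations and variances are well defined)
    (hFL2 : ∀ t x, MemLp (fun ω => F t ω x) 2 μ)
    -- (i) step sizes in [0,1]
    (hζ01 : ∀ t x ω, ζ t ω x ∈ Set.Icc (0 : ℝ) 1)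
    -- (ii) Robbins–Monro conditions
    (hζ_div : ∀ x, ∀ᵐ ω ∂μ,
      Tendsto (fun T => ∑ t ∈ Finset.range T, ζ t ω x) atTop atTop)
    (hζ_sq : ∀ x, ∀ᵐ ω ∂μ, Summable fun t => (ζ t ω x) ^ 2)
    -- (iii) contraction of the conditional mean
    (hκ : κ ∈ Set.Ico (0 : ℝ) 1)
    (hc_nonneg : ∀ t ω, 0 ≤ c t ω)
    (hc_tendsto : ∀ᵐ ω ∂μ, Tendsto (fun t => c t ω) atTop (nhds 0))
    (hmean : ∀ t, ∀ᵐ ω ∂μ,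
      (⨆ x, |(μ[fun ω' => F t ω' x | ℱ t]) ω|) ≤ κ * (⨆ x, |Δ t ω x|) + c t ω)
    -- (iv) bounded conditional variance
    (hvar : ∀ t x, ∀ᵐ ω ∂μ,
      (μ[fun ω' => (F t ω' x - (μ[fun ω'' => F t ω'' x | ℱ t]) ω') ^ 2 | ℱ t]) ω ≤
        K * (1 + κ * (⨆ x, |Δ t ω x|)) ^ 2) :
    ∀ᵐ ω ∂μ, Tendsto (fun t => ⨆ x, |Δ t ω x|) atTop (nhds 0) := by
  classical
  have hle : ∀ (g : X → ℝ) x, |g x| ≤ ⨆ y, |g y| := fun g x =>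
    le_ciSup (f := fun y => |g y|) (Set.finite_range _).bddAbove x
  set b : ℕ → Ω → ℝ := fun t ω => salRunMax (fun s => ⨆ x, |Δ s ω x|) t with hb
  have hb1 : ∀ t ω, 1 ≤ b t ω := by
    intro t ω
    induction t with
    | zero => exact le_max_left _ _
    | succ t ih => exact ih.trans (le_max_left _ _)
  have hbm : ∀ ω, Monotone fun t => b t ω := fun ω =>
    monotone_nat_of_le_succ fun t => le_max_left _ _
  have hbd : ∀ t ω, (⨆ x, |Δ t ω x|) ≤ b t ω := by
    intro t ω
    cases t with
    | zero => exact le_max_right _ _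
    | succ t => exact le_max_right _ _
  have hnm : ∀ t, Measurable[ℱ t] fun ω => ⨆ x, |Δ t ω x| := fun t =>
    Measurable.iSup fun x => (measurable_norm.comp (hΔ t x) :)
  have hbmeas : ∀ t, Measurable[ℱ t] (b t) := by
    intro t
    induction t with
    | zero => exact Measurable.max measurable_const (hnm 0)
    | succ t ih => exact Measurable.max (ih.mono (ℱ.mono (Nat.le_succ t)) le_rfl) (hnm (t+1))
  obtain ⟨hκ0, hκ1⟩ := hκ
  have hnoise : ∀ x, ∀ᵐ ω ∂μ, CauchySeq (fun t => ∑ s ∈ Finset.range t,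
      ζ s ω x * ((F s ω x - (μ[fun ω' => F s ω' x | ℱ s]) ω) / b s ω)) := by
    intro x
    refine sal_noise_conv μ ℱ (fun t ω => ζ t ω x) (fun t ω => F t ω x) b
      (max K 0 * (1 + κ) ^ 2) (by positivity) (fun t => hζ t x) hbmeas (fun t => hF t x)
      (fun t => hFL2 t x) (fun t ω => hζ01 t x ω) hb1 (hζ_sq x) fun t => ?_
    filter_upwards [hvar t x] with ω hω
    refine hω.trans ?_
    have h0 : 0 ≤ ⨆ x, |Δ t ω x| := Real.iSup_nonneg fun _ => abs_nonneg _
    have h1 : 1 + κ * (⨆ x, |Δ t ω x|) ≤ (1 + κ) * b t ω := by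
      have := mul_le_mul_of_nonneg_left (hbd t ω) hκ0
      linarith [hb1 t ω]
    calc K * (1 + κ * (⨆ x, |Δ t ω x|)) ^ 2
        ≤ max K 0 * (1 + κ * (⨆ x, |Δ t ω x|)) ^ 2 :=
          mul_le_mul_of_nonneg_right (le_max_left _ _) (sq_nonneg _)
      _ ≤ max K 0 * ((1 + κ) * b t ω) ^ 2 :=
          mul_le_mul_of_nonneg_left (pow_le_pow_left₀ (by positivity) h1 2) (le_max_right _ _)
      _ = _ := by ring
  filter_upwards [ae_all_iff.2 hnoise, ae_all_iff.2 hζ_div, hc_tendsto, ae_all_iff.2 hmean]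
    with ω h1 h2 h3 h4
  have hdet := sal_det (fun t x => ζ t ω x) (fun t x => Δ t ω x)
    (fun t x => (F t ω x - (μ[fun ω' => F t ω' x | ℱ t]) ω) / b t ω)
    (fun t x => (μ[fun ω' => F t ω' x | ℱ t]) ω) (fun t => c t ω) (fun t => b t ω) κ ⟨hκ0, hκ1⟩
    (fun t x => hζ01 t x ω)
    (fun t x => by
      have hb0 : b t ω ≠ 0 := by have := hb1 t ω; positivity
      rw [mul_div_cancel₀ _ hb0, hrec]; ring)
    (hbm ω) (fun t => hb1 t ω) (fun t x => (hle _ x).trans (hbd t ω))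
    (fun t M hM hx => max_le hM (ciSup_le hx)) h2 h1 h3
    (fun t L hL x => by
      refine (hle (fun x => (μ[fun ω' => F t ω' x | ℱ t]) ω) x).trans ((h4 t).trans ?_)
      have := mul_le_mul_of_nonneg_left (ciSup_le hL) hκ0
      linarith)
  rw [Metric.tendsto_atTop]
  intro ε hε
  obtain ⟨N, hN⟩ := eventually_atTop.1 (hdet (ε/2) (by positivity))
  refine ⟨N, fun t ht => ?_⟩
  have h0 : 0 ≤ ⨆ x, |Δ t ω x| := Real.iSup_nonneg fun _ => abs_nonneg _
  rw [Real.dist_eq, sub_zero, abs_of_nonneg h0]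
  exact (ciSup_le (hN t ht)).trans_lt (by linarith)
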